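/- Let m ≥ 6 with m ≡ 0 (mod 6) be a fundamental point of c such that m - 1 and m + 1 are both prime, and let m' be the least fundamental point of c with m' > m (assuming one exists). Then m' ≥ 2m. -/

import Mathlib

/-- The sequence `c` from the paper: `c 1 = 2` and, for `n ≥ 2`,
`c n = c (n-1) + gcd (n, c (n-1))` if `n` is even, and
`c n = c (n-1) + gcd (n-2, c (n-1))` if `n` is odd. -/
def c : ℕ → ℕ
  | 0 => 0
  | 1 => 2
  | n + 2 =>
    c (n + 1) +
      (if (n + 2) % 2 = 0 then Nat.gcd (n + 2) (c (n + 1)) else Nat.gcd n (c (n + 1)))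

/-- A fundamental point of `c`: an integer `n ≥ 2` with `c n = 2 n`. -/
def IsFundamentalC (n : ℕ) : Prop := 2 ≤ n ∧ c n = 2 * n

theorem c_add_two_of_even {n : ℕ} (h : n % 2 = 0) :
    c (n + 2) = c (n + 1) + Nat.gcd (n + 2) (c (n + 1)) := by
  rw [c, if_pos (by omega)]

theorem c_add_two_of_odd {n : ℕ} (h : n % 2 = 1) :
    c (n + 2) = c (n + 1) + Nat.gcd n (c (n + 1)) := by
  rw [c, if_neg (by omega)]

theorem c_lt_c_succ (n : ℕ) : c n < c (n + 1) := by
  rcases n with _ | n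
  · simp [c]
  · rcases Nat.mod_two_eq_zero_or_one n with h | h
    · have := Nat.gcd_pos_of_pos_left (c (n + 1)) (show 0 < n + 2 by omega)
      rw [c_add_two_of_even h]
      omega
    · have := Nat.gcd_pos_of_pos_left (c (n + 1)) (show 0 < n by omega)
      rw [c_add_two_of_odd h]
      omega

theorem c_add_le (n k : ℕ) : c n + k ≤ c (n + k) := by
  induction k with
  | zero => simp
  | succ k ih =>
    have := c_lt_c_succ (n + k)
    rw [← Nat.add_assoc n k 1]
    omega

/-- The first three values of `c` after a fundamental point divisible by `6`. -/
theorem c_after_fundamental {m : ℕ} (hpos : 0 < m) (hmod : m % 6 = 0) (hfund : c m = 2 * m) :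
    c (m + 1) = 2 * m + 1 ∧ c (m + 2) = 2 * m + 2 ∧ c (m + 3) = 3 * m + 3 := by
  have h1 : c (m + 1) = 2 * m + 1 := by
    obtain ⟨k, rfl⟩ : ∃ k, m = k + 1 := ⟨m - 1, by omega⟩
    have hg : Nat.gcd k (2 * (k + 1)) = 1 := by
      rw [show 2 * (k + 1) = 2 + k * 2 by ring, Nat.gcd_add_mul_left_right]
      exact Nat.coprime_two_right.mpr (Nat.odd_iff.mpr (by omega))
    rw [c_add_two_of_odd (by omega), hfund, hg]
  have h2 : c (m + 2) = 2 * m + 2 := by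
    have hg : Nat.gcd (m + 2) (2 * m + 1) = 1 := by
      have hd : Nat.gcd (m + 2) (2 * m + 1) ∣ 3 := by
        have h := Nat.dvd_sub ((Nat.gcd_dvd_left (m + 2) (2 * m + 1)).mul_left 2)
          (Nat.gcd_dvd_right (m + 2) (2 * m + 1))
        rwa [show 2 * (m + 2) - (2 * m + 1) = 3 by omega] at h
      rcases (Nat.dvd_prime Nat.prime_three).mp hd with h | h
      · exact h
      · have hdvd := Nat.gcd_dvd_left (m + 2) (2 * m + 1)
        rw [h] at hdvd
        omega
    rw [c_add_two_of_even (by omega), h1, hg]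
  refine ⟨h1, h2, ?_⟩
  have hg : Nat.gcd (m + 1) (2 * m + 2) = m + 1 :=
    Nat.gcd_eq_left ⟨2, by ring⟩
  rw [c_add_two_of_odd (n := m + 1) (by omega), h2, hg]
  ring

/-- If `m ≥ 6`, `m ≡ 0 (mod 6)`, is a fundamental point of `c` with `m ∓ 1` twin primes,
and `m'` is the least fundamental point of `c` greater than `m`, then `m' ≥ 2 m`. -/
theorem next_fundamental_point_ge_double
    (m m' : ℕ) (h6 : 6 ≤ m) (hmod : m % 6 = 0) (hfund : c m = 2 * m)
    (hp : Nat.Prime (m - 1)) (hp' : Nat.Prime (m + 1))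
    (hm' : IsFundamentalC m') (hlt : m < m')
    (hleast : ∀ k : ℕ, IsFundamentalC k → m < k → m' ≤ k) :
    2 * m ≤ m' := by
  obtain ⟨h1, h2, h3⟩ := c_after_fundamental (by omega) hmod hfund
  obtain ⟨-, hc⟩ := hm'
  have hne1 : m' ≠ m + 1 := by rintro rfl; omega
  have hne2 : m' ≠ m + 2 := by rintro rfl; omega
  obtain ⟨k, rfl⟩ : ∃ k, m' = m + 3 + k := ⟨m' - (m + 3), by omega⟩
  have := c_add_le (m + 3) k
  omega
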